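/- arXiv:2509.14812 — 4 statements merged into one kernel-verified Lean document; each statement's English description precedes it below -/
import Mathlib

section
/- Let r ≥ 2 be an integer, ζ ∈ ℂ a primitive r-th root of unity, and σ the ℂ-algebra automorphism of ℂ[X,Y] with σ(X) = ζ·X and σ(Y) = ζ·Y. For every pair (a,b) ∈ ℂ² with (a,b) ≠ (0,0), the ideal I = (a·X + b·Y) + m^r of ℂ[X,Y] (where m = (X,Y)) satisfies: (1) m^r ⊆ I; (2) σ maps I onto I; (3) the quotient ℂ[X,Y]/I has dimension r as a ℂ-vector space; and (4) for every k ∈ {0,1,…,r−1}, the eigenspace with eigenvalue ζ^k of the ℂ-linear endomorphism of ℂ[X,Y]/I induced by σ is one-dimensional. -/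
open MvPolynomial

/-- Let `r ≥ 2`, `ζ ∈ ℂ` a primitive `r`-th root of unity, and `σ` the
`ℂ`-algebra automorphism of `ℂ[X,Y]` with `σ(X) = ζ·X`, `σ(Y) = ζ·Y`.  For every
`(a,b) ≠ (0,0)`, the ideal `I = (a·X + b·Y) + m^r` (where `m = (X,Y)`) satisfies:
(1) `m^r ⊆ I`; (2) `σ` maps `I` onto `I`; (3) `ℂ[X,Y]/I` has `ℂ`-dimension `r`;
(4) for each `k < r`, the eigenspace of the induced endomorphism of `ℂ[X,Y]/I`
with eigenvalue `ζ^k` is one-dimensional. -/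
theorem stmt_0 (r : ℕ) (hr : 2 ≤ r) (ζ : ℂ) (hζ : IsPrimitiveRoot ζ r)
    (σ : MvPolynomial (Fin 2) ℂ ≃ₐ[ℂ] MvPolynomial (Fin 2) ℂ)
    (hσX : σ (X 0) = ζ • X 0) (hσY : σ (X 1) = ζ • X 1)
    (a b : ℂ) (hab : (a, b) ≠ ((0 : ℂ), (0 : ℂ)))
    (m I : Ideal (MvPolynomial (Fin 2) ℂ))
    (hm : m = Ideal.span {X 0, X 1})
    (hI : I = Ideal.span {C a * X 0 + C b * X 1} ⊔ m ^ r) :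
    m ^ r ≤ I ∧
    σ '' (I : Set (MvPolynomial (Fin 2) ℂ)) = (I : Set (MvPolynomial (Fin 2) ℂ)) ∧
    Module.finrank ℂ (MvPolynomial (Fin 2) ℂ ⧸ I) = r ∧
    ∃ τ : (MvPolynomial (Fin 2) ℂ ⧸ I) →ₗ[ℂ] (MvPolynomial (Fin 2) ℂ ⧸ I),
      (∀ p : MvPolynomial (Fin 2) ℂ,
        τ (Ideal.Quotient.mk I p) = Ideal.Quotient.mk I (σ p)) ∧
      ∀ k : ℕ, k < r →
        Module.finrank ℂ (Module.End.eigenspace τ (ζ ^ k)) = 1 := by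
  classical
  -- the complementary linear form
  obtain ⟨c, d, hcd⟩ : ∃ c d : ℂ, c * b - d * a = 1 := by
    by_cases hb : b = 0
    · have ha : a ≠ 0 := by
        rintro rfl
        exact hab (by rw [hb])
      exact ⟨0, -a⁻¹, by field_simp; simp⟩
    · exact ⟨b⁻¹, 0, by field_simp; simp⟩
  let φ : MvPolynomial (Fin 2) ℂ →ₐ[ℂ] Polynomial ℂ :=
    MvPolynomial.aeval ![Polynomial.C b * Polynomial.X, Polynomial.C (-a) * Polynomial.X]
  let ψ : Polynomial ℂ →ₐ[ℂ] MvPolynomial (Fin 2) ℂ :=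
    Polynomial.aeval (C c * X 0 + C d * X 1)
  have hφ0 : φ (X 0) = Polynomial.C b * Polynomial.X := by simp [φ]
  have hφ1 : φ (X 1) = Polynomial.C (-a) * Polynomial.X := by simp [φ]
  have hφC : ∀ z, φ (C z) = Polynomial.C z := fun z => by
    simp [φ, Polynomial.algebraMap_eq]
  have hψX : ψ Polynomial.X = C c * X 0 + C d * X 1 := by simp [ψ]
  have hψC : ∀ z, ψ (Polynomial.C z) = C z := fun z => by
    simp [ψ, MvPolynomial.algebraMap_eq]
  have hφψ : ∀ q, φ (ψ q) = q := by
    intro q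
    have : φ.comp ψ = AlgHom.id ℂ _ := by
      apply Polynomial.algHom_ext
      simp only [AlgHom.comp_apply, hψX, map_add, map_mul, hφC, hφ0, hφ1, AlgHom.id_apply]
      have h1 : (Polynomial.C c * Polynomial.C b - Polynomial.C d * Polynomial.C a : Polynomial ℂ) = 1 := by
        rw [← Polynomial.C_mul, ← Polynomial.C_mul, ← Polynomial.C_sub, hcd, Polynomial.C_1]
      simp only [Polynomial.C_neg]
      linear_combination Polynomial.X * h1
    exact DFunLike.congr_fun this q
  have hC1 : (C c * C b - C d * C a : MvPolynomial (Fin 2) ℂ) = 1 := by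
    rw [← C_mul, ← C_mul, ← C_sub, hcd, C_1]
  have hlI : C a * X 0 + C b * X 1 ∈ I := by
    rw [hI]
    exact Ideal.mem_sup_left (Ideal.subset_span rfl)
  have hmI : m ^ r ≤ I := hI ▸ le_sup_right
  have hψφ : ∀ p, p - ψ (φ p) ∈ I := by
    intro p
    have : ((Ideal.Quotient.mkₐ ℂ I).comp (ψ.comp φ)) = Ideal.Quotient.mkₐ ℂ I := by
      apply MvPolynomial.algHom_ext
      intro i
      simp only [AlgHom.comp_apply, Ideal.Quotient.mkₐ_eq_mk]
      rw [Ideal.Quotient.eq]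
      fin_cases i
      · simp only [Fin.zero_eta, hφ0, map_mul, hψC, hψX]
        have : C b * (C c * X 0 + C d * X 1) - X 0
          = C d * (C a * X 0 + C b * X 1 : MvPolynomial (Fin 2) ℂ) := by
          linear_combination X 0 * hC1
        rw [this]
        exact I.mul_mem_left _ hlI
      · simp only [Fin.mk_one, hφ1, map_mul, hψC, hψX]
        have : C (-a) * (C c * X 0 + C d * X 1) - X 1
          = -C c * (C a * X 0 + C b * X 1 : MvPolynomial (Fin 2) ℂ) := by
          rw [C_neg]
          linear_combination X 1 * hC1
        rw [this]
        exact I.mul_mem_left _ hlI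
    have h2 := DFunLike.congr_fun this p
    simp only [AlgHom.comp_apply, Ideal.Quotient.mkₐ_eq_mk] at h2
    exact (Ideal.Quotient.eq).1 h2.symm
  have hmem : ∀ p, p ∈ I ↔ Polynomial.X ^ r ∣ φ p := by
    intro p
    constructor
    · have hle : I ≤ (Ideal.span {(Polynomial.X : Polynomial ℂ) ^ r}).comap φ := by
        rw [hI]
        refine sup_le ?_ ?_
        · rw [Ideal.span_le, Set.singleton_subset_iff]
          have : φ (C a * X 0 + C b * X 1) = 0 := by
            simp only [map_add, map_mul, hφC, hφ0, hφ1, Polynomial.C_neg]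
            ring
          simp [this]
        · have h1 : m ≤ (Ideal.span {(Polynomial.X : Polynomial ℂ)}).comap φ := by
            rw [hm, Ideal.span_le]
            rintro x (rfl | rfl)
            · simp only [SetLike.mem_coe, Ideal.mem_comap, hφ0, Ideal.mem_span_singleton]
              exact dvd_mul_left _ _
            · simp only [SetLike.mem_coe, Ideal.mem_comap, hφ1, Ideal.mem_span_singleton]
              exact dvd_mul_left _ _
          calc m ^ r ≤ ((Ideal.span {(Polynomial.X : Polynomial ℂ)}).comap φ) ^ r :=
                Ideal.pow_right_mono h1 r
            _ ≤ ((Ideal.span {(Polynomial.X : Polynomial ℂ)}) ^ r).comap φ :=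
                Ideal.le_comap_pow _ _
            _ = _ := by rw [Ideal.span_singleton_pow]
      intro hp
      exact Ideal.mem_span_singleton.1 (hle hp)
    · rintro ⟨q, hq⟩
      have h1 := hψφ p
      have h2 : ψ (φ p) ∈ I := by
        rw [hq, map_mul, map_pow, hψX]
        refine I.mul_mem_right _ (hmI (Ideal.pow_mem_pow ?_ r))
        rw [hm]
        exact Ideal.add_mem _ (Ideal.mul_mem_left _ _ (Ideal.subset_span (by simp)))
          (Ideal.mul_mem_left _ _ (Ideal.subset_span (by simp)))
      simpa using I.add_mem h1 h2
  let L : MvPolynomial (Fin 2) ℂ →ₗ[ℂ] (Fin r → ℂ) :=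
    LinearMap.pi fun i => (Polynomial.lcoeff ℂ (i : ℕ)).comp φ.toLinearMap
  have hL : ∀ p i, L p i = (φ p).coeff i := fun p i => rfl
  have hLI : ∀ p, p ∈ I ↔ L p = 0 := by
    intro p
    rw [hmem, Polynomial.X_pow_dvd_iff]
    constructor
    · intro h
      funext i
      exact h i i.2
    · intro h i hi
      exact congrFun h ⟨i, hi⟩
  have hLs : Function.Surjective L := by
    intro v
    refine ⟨ψ (∑ i : Fin r, Polynomial.monomial (i : ℕ) (v i)), ?_⟩
    funext j
    rw [hL, hφψ, Polynomial.finsetSum_coeff]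
    simp [Polynomial.coeff_monomial, Fin.val_inj]
  have hker : I.restrictScalars ℂ = LinearMap.ker L := by
    ext p
    simp [hLI]
  let e : (MvPolynomial (Fin 2) ℂ ⧸ I) ≃ₗ[ℂ] (Fin r → ℂ) :=
    (Submodule.Quotient.restrictScalarsEquiv ℂ I).symm ≪≫ₗ
      Submodule.quotEquivOfEq _ _ hker ≪≫ₗ L.quotKerEquivOfSurjective hLs
  have he : ∀ p, e (Ideal.Quotient.mk I p) = L p := fun p => rfl
  have hφσ : ∀ p, φ (σ p) = (φ p).comp (Polynomial.C ζ * Polynomial.X) := by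
    intro p
    have : φ.comp σ.toAlgHom = (Polynomial.aeval (Polynomial.C ζ * Polynomial.X)).comp φ := by
      apply MvPolynomial.algHom_ext
      intro i
      fin_cases i
      · simp [hσX, hφ0, Polynomial.smul_eq_C_mul, Polynomial.algebraMap_eq]
        ring
      · simp [hσY, hφ1, Polynomial.smul_eq_C_mul, Polynomial.algebraMap_eq]
        ring
    exact DFunLike.congr_fun this p
  have hLσ : ∀ p i, L (σ p) i = ζ ^ (i : ℕ) * L p i := by
    intro p i
    rw [hL, hL, hφσ, Polynomial.comp_C_mul_X_coeff, mul_comm]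
  have hζ0 : ζ ≠ 0 := hζ.ne_zero (by omega)
  have hσI : ∀ p, σ p ∈ I ↔ p ∈ I := by
    intro p
    rw [hLI, hLI, _root_.funext_iff, _root_.funext_iff]
    refine forall_congr' fun i => ?_
    rw [hLσ]
    simp [hζ0]
  refine ⟨hmI, ?_, ?_, ?_⟩
  · ext p
    constructor
    · rintro ⟨q, hq, rfl⟩
      exact (hσI q).2 hq
    · intro hp
      exact ⟨σ.symm p, (hσI _).1 (by simpa using hp), by simp⟩
  · rw [e.finrank_eq]
    simp
  · let D : (Fin r → ℂ) →ₗ[ℂ] (Fin r → ℂ) :=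
      LinearMap.pi fun i => (ζ ^ (i : ℕ)) • LinearMap.proj i
    have hD : ∀ v i, D v i = ζ ^ (i : ℕ) * v i := fun v i => rfl
    refine ⟨e.symm.toLinearMap ∘ₗ D ∘ₗ e.toLinearMap, ?_, ?_⟩
    · intro p
      apply e.injective
      simp only [LinearMap.comp_apply, LinearEquiv.coe_coe, LinearEquiv.apply_symm_apply, he]
      funext i
      rw [hD, hLσ]
    · intro k hk
      have hmemE : ∀ x, x ∈ Module.End.eigenspace
          (e.symm.toLinearMap ∘ₗ D ∘ₗ e.toLinearMap) (ζ ^ k) ↔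
          ∀ i : Fin r, ζ ^ (i : ℕ) * e x i = ζ ^ k * e x i := by
        intro x
        rw [Module.End.mem_eigenspace_iff, ← e.injective.eq_iff, _root_.funext_iff]
        simp [hD]
      rw [finrank_eq_one_iff']
      refine ⟨⟨e.symm (Pi.single ⟨k, hk⟩ 1), ?_⟩, ?_, ?_⟩
      · rw [hmemE]
        intro i
        rw [LinearEquiv.apply_symm_apply]
        by_cases h : i = ⟨k, hk⟩
        · subst h
          rfl
        · simp [Pi.single_eq_of_ne h]
      · intro h
        have h1 := congrArg Subtype.val h
        simp at h1
      · rintro ⟨w, hw⟩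
        refine ⟨e w ⟨k, hk⟩, ?_⟩
        apply Subtype.ext
        apply e.injective
        simp only [SetLike.mk_smul_mk, map_smul, LinearEquiv.apply_symm_apply]
        funext i
        by_cases h : i = ⟨k, hk⟩
        · subst h
          simp
        · have h1 := (hmemE w).1 hw i
          have h2 : e w i = 0 := by
            by_contra h0
            exact h (Fin.ext (hζ.pow_inj i.2 hk (mul_right_cancel₀ h0 h1)))
          simp [Pi.single_eq_of_ne h, h2]
end

section
/- Let r ≥ 2 be an integer, ζ ∈ ℂ a primitive r-th root of unity, and σ the ℂ-algebra automorphism of ℂ[X,Y] with σ(X) = ζ·X and σ(Y) = ζ·Y. Let I be an ideal of ℂ[X,Y] such that: (1) m^N ⊆ I for some natural number N (where m = (X,Y)); (2) σ maps I onto I; (3) the quotient ℂ[X,Y]/I has dimension r as a ℂ-vector space; and (4) for every k ∈ {0,1,…,r−1}, the eigenspace with eigenvalue ζ^k of the ℂ-linear endomorphism of ℂ[X,Y]/I induced by σ is one-dimensional. Then there exists a pair (a,b) ∈ ℂ² with (a,b) ≠ (0,0) such that I = (a·X + b·Y) + m^r. -/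
open MvPolynomial

/-- Key algebraic step: if `X` and `Y` are multiples of `t` modulo `L`, the ideal is `(L) + m^r`. -/
lemma aux_main (r : ℕ) (hr : 2 ≤ r)
    (m I : Ideal (MvPolynomial (Fin 2) ℂ))
    (hm : m = Ideal.span {X 0, X 1})
    (hN : ∃ N : ℕ, m ^ N ≤ I)
    (hdim : Module.finrank ℂ (MvPolynomial (Fin 2) ℂ ⧸ I) = r)
    (L t : MvPolynomial (Fin 2) ℂ) (c : Fin 2 → ℂ) (hL : L ∈ I) (ht : t ∈ m)
    (hc : ∀ i, X i - C (c i) * t ∈ Ideal.span {L}) :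
    I = Ideal.span {L} ⊔ m ^ r := by
  have hfd : FiniteDimensional ℂ (MvPolynomial (Fin 2) ℂ ⧸ I) :=
    FiniteDimensional.of_finrank_pos (by omega)
  have hLI : Ideal.span {L} ≤ I := by
    rw [Ideal.span_le]; simpa using hL
  -- `t ^ r ∈ I`
  have htr : t ^ r ∈ I := by
    obtain ⟨N, hN⟩ := hN
    have h1 : t ^ N ∈ I := hN (Ideal.pow_mem_pow ht N)
    have hnil : IsNilpotent (LinearMap.mulLeft ℂ (Ideal.Quotient.mk I t)) := by
      refine ⟨N, ?_⟩
      rw [LinearMap.pow_mulLeft, ← map_pow, Ideal.Quotient.eq_zero_iff_mem.2 h1]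
      simp
    have h3 := (LinearMap.charpoly_nilpotent_tfae
      (LinearMap.mulLeft ℂ (Ideal.Quotient.mk I t))).out 0 1
    have h4 := h3.1 hnil
    have h5 := LinearMap.aeval_self_charpoly (LinearMap.mulLeft ℂ (Ideal.Quotient.mk I t))
    rw [h4, hdim] at h5
    simp only [map_pow, Polynomial.aeval_X, LinearMap.pow_mulLeft] at h5
    have h6 := LinearMap.congr_fun h5 1
    simp only [LinearMap.mulLeft_apply, mul_one, LinearMap.zero_apply] at h6
    rwa [← map_pow, Ideal.Quotient.eq_zero_iff_mem] at h6
  -- `m ^ r ≤ I`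
  have hmr : m ^ r ≤ I := by
    have h1 : m ≤ Ideal.span {L} ⊔ Ideal.span {t} := by
      have key : ∀ i, X i ∈ Ideal.span {L} ⊔ Ideal.span {t} := fun i => by
        have : (X i : MvPolynomial (Fin 2) ℂ) = (X i - C (c i) * t) + C (c i) * t := by ring
        rw [this]
        exact Ideal.add_mem _ (Ideal.mem_sup_left (hc i))
          (Ideal.mem_sup_right (Ideal.mul_mem_left _ _ (Ideal.mem_span_singleton_self t)))
      rw [hm, Ideal.span_le]
      rintro x (rfl | rfl)
      · exact key 0
      · exact key 1
    have h2 : m.map (Ideal.Quotient.mk I) ≤ Ideal.span {Ideal.Quotient.mk I t} := by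
      refine (Ideal.map_mono h1).trans ?_
      rw [Ideal.map_sup, Ideal.map_span, Ideal.map_span, Set.image_singleton, Set.image_singleton,
        Ideal.Quotient.eq_zero_iff_mem.2 hL]
      simp
    have h3 : (m ^ r).map (Ideal.Quotient.mk I) ≤ ⊥ := by
      rw [Ideal.map_pow]
      refine (Ideal.pow_right_mono h2 r).trans ?_
      rw [Ideal.span_singleton_pow, ← map_pow, Ideal.Quotient.eq_zero_iff_mem.2 htr]
      simp
    intro x hx
    have := h3 (Ideal.mem_map_of_mem _ hx)
    rwa [Ideal.mem_bot, Ideal.Quotient.eq_zero_iff_mem] at this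
  have hJI : Ideal.span {L} ⊔ m ^ r ≤ I := sup_le hLI hmr
  -- normal form
  have hnf : ∀ f : MvPolynomial (Fin 2) ℂ, ∃ g : Polynomial ℂ, g ∈ Polynomial.degreeLT ℂ r ∧
      f - Polynomial.aeval t g ∈ Ideal.span {L} ⊔ m ^ r := by
    intro f
    let q : MvPolynomial (Fin 2) ℂ →ₐ[ℂ] Polynomial ℂ :=
      MvPolynomial.aeval (fun i => Polynomial.C (c i) * Polynomial.X)
    have hq : Ideal.Quotient.mkₐ ℂ (Ideal.span {L}) =
        ((Ideal.Quotient.mkₐ ℂ (Ideal.span {L})).comp (Polynomial.aeval t)).comp q := by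
      apply MvPolynomial.algHom_ext
      intro i
      simp only [AlgHom.comp_apply, q, MvPolynomial.aeval_X, map_mul, Polynomial.aeval_C,
        Polynomial.aeval_X]
      rw [← map_mul]
      exact Ideal.Quotient.eq.2 (hc i)
    have h1 : f - Polynomial.aeval t (q f) ∈ Ideal.span {L} :=
      Ideal.Quotient.eq.1 (DFunLike.congr_fun hq f)
    have hmon : (Polynomial.X ^ r : Polynomial ℂ).Monic := Polynomial.monic_X_pow r
    refine ⟨q f %ₘ Polynomial.X ^ r, ?_, ?_⟩
    · rw [Polynomial.mem_degreeLT]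
      have := Polynomial.degree_modByMonic_lt (q f) hmon
      rwa [Polynomial.degree_X_pow] at this
    · have h2 := congrArg (Polynomial.aeval t) (Polynomial.modByMonic_add_div (q f) (Polynomial.X ^ r))
      simp only [map_add, map_mul, map_pow, Polynomial.aeval_X] at h2
      have h3 : f - Polynomial.aeval t (q f %ₘ Polynomial.X ^ r) =
          (f - Polynomial.aeval t (q f)) +
            t ^ r * Polynomial.aeval t (q f /ₘ Polynomial.X ^ r) := by
        rw [← h2]; ring
      rw [h3]
      exact Ideal.add_mem _ (Ideal.mem_sup_left h1)
        (Ideal.mem_sup_right (Ideal.mul_mem_right _ _ (Ideal.pow_mem_pow ht r)))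
  let φ : Polynomial.degreeLT ℂ r →ₗ[ℂ] (MvPolynomial (Fin 2) ℂ ⧸ I) :=
    ((Ideal.Quotient.mkₐ ℂ I).comp (Polynomial.aeval t)).toLinearMap.comp
      (Polynomial.degreeLT ℂ r).subtype
  have hφ : ∀ g, φ g = Ideal.Quotient.mk I (Polynomial.aeval t (g : Polynomial ℂ)) :=
    fun g => rfl
  have hsurj : Function.Surjective φ := by
    intro y
    obtain ⟨f, rfl⟩ := Ideal.Quotient.mk_surjective y
    obtain ⟨g, hg, hfg⟩ := hnf f
    refine ⟨⟨g, hg⟩, ?_⟩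
    rw [hφ]
    exact (Ideal.Quotient.eq.2 (hJI hfg)).symm
  have hfd2 : FiniteDimensional ℂ (Polynomial.degreeLT ℂ r) :=
    Module.Finite.equiv (Polynomial.degreeLTEquiv ℂ r).symm
  have hfr : Module.finrank ℂ (Polynomial.degreeLT ℂ r) = r := by
    rw [(Polynomial.degreeLTEquiv ℂ r).finrank_eq]; simp
  have hinj : Function.Injective φ :=
    (LinearMap.injective_iff_surjective_of_finrank_eq_finrank (hfr.trans hdim.symm)).2 hsurj
  refine le_antisymm ?_ hJI
  intro f hf
  obtain ⟨g, hg, hfg⟩ := hnf f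
  have h1 : Polynomial.aeval t g ∈ I := by
    have := Ideal.sub_mem _ hf (hJI hfg)
    simpa using this
  have h2 : (⟨g, hg⟩ : Polynomial.degreeLT ℂ r) = 0 := by
    apply hinj
    rw [map_zero, hφ]
    exact Ideal.Quotient.eq_zero_iff_mem.2 h1
  have h3 : g = 0 := congrArg Subtype.val h2
  simpa [h3] using hfg

/-- Let `r ≥ 2`, `ζ` a primitive `r`-th root of unity, `σ` the `ℂ`-algebra
automorphism of `ℂ[X,Y]` with `σ(X) = ζ·X`, `σ(Y) = ζ·Y`.  If an ideal `I` satisfies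
`m^N ⊆ I` for some `N`, `σ(I) = I`, `dim_ℂ ℂ[X,Y]/I = r`, and each eigenspace of the
induced endomorphism of `ℂ[X,Y]/I` with eigenvalue `ζ^k` (for `0 ≤ k < r`) is
one-dimensional, then `I = (a·X + b·Y) + m^r` for some `(a,b) ≠ (0,0)`. -/
theorem stmt_1 (r : ℕ) (hr : 2 ≤ r) (ζ : ℂ) (hζ : IsPrimitiveRoot ζ r)
    (σ : MvPolynomial (Fin 2) ℂ ≃ₐ[ℂ] MvPolynomial (Fin 2) ℂ)
    (hσX : σ (X 0) = ζ • X 0) (hσY : σ (X 1) = ζ • X 1)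
    (m I : Ideal (MvPolynomial (Fin 2) ℂ))
    (hm : m = Ideal.span {X 0, X 1})
    (hN : ∃ N : ℕ, m ^ N ≤ I)
    (hσI : σ '' (I : Set (MvPolynomial (Fin 2) ℂ)) = (I : Set (MvPolynomial (Fin 2) ℂ)))
    (hdim : Module.finrank ℂ (MvPolynomial (Fin 2) ℂ ⧸ I) = r)
    (heig : ∃ τ : (MvPolynomial (Fin 2) ℂ ⧸ I) →ₗ[ℂ] (MvPolynomial (Fin 2) ℂ ⧸ I),
      (∀ p : MvPolynomial (Fin 2) ℂ,
        τ (Ideal.Quotient.mk I p) = Ideal.Quotient.mk I (σ p)) ∧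
      ∀ k : ℕ, k < r →
        Module.finrank ℂ (Module.End.eigenspace τ (ζ ^ k)) = 1) :
    ∃ a b : ℂ, (a, b) ≠ ((0 : ℂ), (0 : ℂ)) ∧
      I = Ideal.span {C a * X 0 + C b * X 1} ⊔ m ^ r := by
  obtain ⟨τ, hτ, he⟩ := heig
  have h1 := he 1 (by omega)
  rw [pow_one] at h1
  have hx : Ideal.Quotient.mk I (X 0) ∈ Module.End.eigenspace τ ζ := by
    rw [Module.End.mem_eigenspace_iff, hτ, hσX]; rfl
  have hy : Ideal.Quotient.mk I (X 1) ∈ Module.End.eigenspace τ ζ := by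
    rw [Module.End.mem_eigenspace_iff, hτ, hσY]; rfl
  obtain ⟨v, -, hv⟩ := finrank_eq_one_iff'.1 h1
  obtain ⟨p, hp⟩ := hv ⟨_, hx⟩
  obtain ⟨q, hq⟩ := hv ⟨_, hy⟩
  have hp' : p • (v : MvPolynomial (Fin 2) ℂ ⧸ I) = Ideal.Quotient.mk I (X 0) :=
    congrArg Subtype.val hp
  have hq' : q • (v : MvPolynomial (Fin 2) ℂ ⧸ I) = Ideal.Quotient.mk I (X 1) :=
    congrArg Subtype.val hq
  have hC : ∀ (a : ℂ) (f : MvPolynomial (Fin 2) ℂ),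
      Ideal.Quotient.mk I (C a * f) = a • Ideal.Quotient.mk I f := by
    intro a f
    rw [← MvPolynomial.smul_eq_C_mul]; rfl
  have hdep : ∃ a b : ℂ, (a, b) ≠ ((0 : ℂ), (0 : ℂ)) ∧ C a * X 0 + C b * X 1 ∈ I := by
    by_cases hp0 : p = 0
    · refine ⟨1, 0, by simp, ?_⟩
      rw [← Ideal.Quotient.eq_zero_iff_mem, map_add, hC, hC, ← hp', ← hq', hp0]
      simp
    · refine ⟨q, -p, by simp [hp0], ?_⟩
      rw [← Ideal.Quotient.eq_zero_iff_mem, map_add, hC, hC, ← hp', ← hq', smul_smul, smul_smul,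
        ← add_smul]
      have : q * p + -p * q = 0 := by ring
      rw [this, zero_smul]
  obtain ⟨a, b, hab, hL⟩ := hdep
  refine ⟨a, b, hab, ?_⟩
  have hX0 : (X 0 : MvPolynomial (Fin 2) ℂ) ∈ m := by
    rw [hm]; exact Ideal.subset_span (by simp)
  have hX1 : (X 1 : MvPolynomial (Fin 2) ℂ) ∈ m := by
    rw [hm]; exact Ideal.subset_span (by simp)
  by_cases ha : a = 0
  · have hb : b ≠ 0 := by
      rintro rfl
      exact hab (by rw [ha])
    refine aux_main r hr m I hm hN hdim _ (X 0) ![1, 0] hL hX0 ?_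
    intro i
    rw [Ideal.mem_span_singleton]
    fin_cases i
    · simp
    · refine ⟨C b⁻¹, ?_⟩
      have : (C b * C b⁻¹ : MvPolynomial (Fin 2) ℂ) = 1 := by
        rw [← C_mul, mul_inv_cancel₀ hb, C_1]
      simp [ha]
      linear_combination -(X 1) * this
  · refine aux_main r hr m I hm hN hdim _ (X 1) ![-(a⁻¹ * b), 1] hL hX1 ?_
    intro i
    rw [Ideal.mem_span_singleton]
    fin_cases i
    · refine ⟨C a⁻¹, ?_⟩
      have : (C a * C a⁻¹ : MvPolynomial (Fin 2) ℂ) = 1 := by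
        rw [← C_mul, mul_inv_cancel₀ ha, C_1]
      simp only [Fin.zero_eta, Matrix.cons_val_zero, C_neg, C_mul]
      linear_combination -(X 0) * this
    · simp
end

section
/- Let r ≥ 2 be an integer, ζ ∈ ℂ a primitive r-th root of unity, and σ the ℂ-algebra automorphism of ℂ[X,Y] with σ(X) = ζ·X and σ(Y) = ζ·Y. The assignment sending the line through a nonzero vector (a,b) ∈ ℂ² to the ideal (a·X + b·Y) + m^r defines a bijection from the projectivization ℙ(ℂ²) of ℂ² onto the set of ideals I of ℂ[X,Y] satisfying: m^N ⊆ I for some natural number N; σ(I) = I; and for every k ∈ {0,1,…,r−1}, the eigenspace with eigenvalue ζ^k of the ℂ-linear endomorphism of ℂ[X,Y]/I induced by σ is one-dimensional. -/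
open MvPolynomial

namespace PunctualHilb

abbrev R := MvPolynomial (Fin 2) ℂ

noncomputable abbrev M : Ideal R := Ideal.span {X 0, X 1}

noncomputable abbrev L (v : ℂ × ℂ) : R := C v.1 * X 0 + C v.2 * X 1

noncomputable abbrev J (r : ℕ) (v : ℂ × ℂ) : Ideal R := Ideal.span {L v} ⊔ M ^ r

lemma L_mem_M (v : ℂ × ℂ) : L v ∈ M :=
  Ideal.add_mem _ (Ideal.mul_mem_left _ _ (Ideal.subset_span (by simp)))
    (Ideal.mul_mem_left _ _ (Ideal.subset_span (by simp)))

lemma map_L (g : R →ₐ[ℂ] R) (c : ℂ) (h0 : g (X 0) = c • X 0) (h1 : g (X 1) = c • X 1)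
    (v : ℂ × ℂ) : g (L v) = c • L v := by
  have hC : ∀ a : ℂ, g (C a) = C a := fun a => g.commutes a
  simp only [L, map_add, map_mul, hC, h0, h1, smul_add, mul_smul_comm]

lemma M_le_comap (g : R →ₐ[ℂ] R) (c : ℂ) (h0 : g (X 0) = c • X 0) (h1 : g (X 1) = c • X 1) :
    M ≤ M.comap g := by
  rw [Ideal.span_le]
  rintro p (rfl | rfl)
  · simp only [SetLike.mem_coe, Ideal.mem_comap, h0]
    exact Submodule.smul_of_tower_mem _ c (Ideal.subset_span (by simp))
  · simp only [SetLike.mem_coe, Ideal.mem_comap, h1]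
    exact Submodule.smul_of_tower_mem _ c (Ideal.subset_span (by simp))

lemma J_le_comap (r : ℕ) (v : ℂ × ℂ) (g : R →ₐ[ℂ] R) (c : ℂ)
    (h0 : g (X 0) = c • X 0) (h1 : g (X 1) = c • X 1) :
    J r v ≤ (J r v).comap g := by
  refine sup_le ?_ ?_
  · rw [Ideal.span_le]
    rintro p rfl
    simp only [SetLike.mem_coe, Ideal.mem_comap]
    rw [map_L g c h0 h1]
    exact Submodule.smul_of_tower_mem _ c (Ideal.mem_sup_left (Ideal.subset_span rfl))
  · refine le_trans (Ideal.pow_right_mono (M_le_comap g c h0 h1) r) ?_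
    refine le_trans (Ideal.le_comap_pow _ r) (Ideal.comap_mono le_sup_right)

/-- restriction to the line `a X + b Y = 0` -/
noncomputable def phi (v : ℂ × ℂ) : R →ₐ[ℂ] Polynomial ℂ :=
  aeval ![Polynomial.C (-v.2) * Polynomial.X, Polynomial.C v.1 * Polynomial.X]

lemma phi_L (v w : ℂ × ℂ) :
    phi v (L w) = Polynomial.C (v.1 * w.2 - v.2 * w.1) * Polynomial.X := by
  have hC : ∀ a : ℂ, phi v (C a) = Polynomial.C a := fun a => (phi v).commutes a
  simp only [L, map_add, map_mul, hC]
  simp [phi]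
  ring

lemma J_le_phi (r : ℕ) (v : ℂ × ℂ) :
    J r v ≤ (Ideal.span {(Polynomial.X : Polynomial ℂ) ^ r}).comap (phi v) := by
  refine sup_le ?_ ?_
  · rw [Ideal.span_le]
    rintro p rfl
    simp only [SetLike.mem_coe, Ideal.mem_comap]
    rw [phi_L, mul_comm v.1]
    simp [mul_comm]
  · have : M ≤ (Ideal.span {(Polynomial.X : Polynomial ℂ)}).comap (phi v) := by
      rw [Ideal.span_le]
      rintro p (rfl | rfl) <;>
        simp only [SetLike.mem_coe, Ideal.mem_comap, Ideal.mem_span_singleton] <;>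
        simp [phi]
    refine le_trans (Ideal.pow_right_mono this r) ?_
    refine le_trans (Ideal.le_comap_pow _ r) (Ideal.comap_mono ?_)
    rw [Ideal.span_singleton_pow]

lemma exists_compl (v : ℂ × ℂ) (hv : v ≠ 0) : ∃ w : ℂ × ℂ, v.1 * w.2 - v.2 * w.1 = 1 := by
  by_cases h : v.1 = 0
  · have h2 : v.2 ≠ 0 := fun h2 => hv (Prod.ext h h2)
    exact ⟨(-v.2⁻¹, 0), by simp [h2]⟩
  · exact ⟨(0, v.1⁻¹), by simp [h]⟩

lemma pow_notMem (r : ℕ) (v w : ℂ × ℂ) (hw : v.1 * w.2 - v.2 * w.1 = 1) (k : ℕ) (hk : k < r) :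
    L w ^ k ∉ J r v := by
  intro h
  have := J_le_phi r v h
  rw [Ideal.mem_comap, map_pow, phi_L, hw, Ideal.mem_span_singleton, Polynomial.X_pow_dvd_iff]
    at this
  simpa using this k hk

lemma sub_mem (r : ℕ) (v w : ℂ × ℂ) (hw : v.1 * w.2 - v.2 * w.1 = 1) (p : R) :
    p - Polynomial.aeval (L w) (phi v p) ∈ Ideal.span {L v} := by
  set I : Ideal R := Ideal.span {L v} with hI
  have key : ((Ideal.Quotient.mkₐ ℂ I).comp ((Polynomial.aeval (L w)).comp (phi v)))
      = Ideal.Quotient.mkₐ ℂ I := by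
    have e : (C v.1 * C w.2 - C v.2 * C w.1 : R) = 1 := by
      rw [← C_mul, ← C_mul, ← C_sub, hw, C_1]
    apply MvPolynomial.algHom_ext
    intro i
    simp only [AlgHom.comp_apply, Ideal.Quotient.mkₐ_eq_mk]
    rw [Ideal.Quotient.eq, hI, Ideal.mem_span_singleton]
    fin_cases i
    · refine ⟨- C w.2, ?_⟩
      simp [phi, algebraMap_eq]
      linear_combination (X 0) * e
    · refine ⟨C w.1, ?_⟩
      simp [phi, algebraMap_eq]
      linear_combination (X 1) * e
  have := DFunLike.congr_fun key p
  simp only [AlgHom.comp_apply, Ideal.Quotient.mkₐ_eq_mk] at this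
  rw [← Ideal.Quotient.eq]
  exact this.symm

lemma sub_mem_J (r : ℕ) (v w : ℂ × ℂ) (hw : v.1 * w.2 - v.2 * w.1 = 1) (p : R) :
    p - ∑ k : Fin r, (phi v p).coeff k • L w ^ (k : ℕ) ∈ J r v := by
  have h1 := Ideal.mem_sup_left (T := M ^ r) (sub_mem r v w hw p)
  set q := phi v p
  have h2 : Polynomial.aeval (L w) q - ∑ k : Fin r, q.coeff k • L w ^ (k : ℕ) ∈ J r v := by
    apply Ideal.mem_sup_right
    rw [Fin.sum_univ_eq_sum_range (fun k => q.coeff k • L w ^ k) r,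
      Polynomial.aeval_eq_sum_range' (n := q.natDegree + 1 + r) (by omega),
      add_comm, Finset.sum_range_add, add_sub_cancel_left]
    refine Ideal.sum_mem _ fun k _ => Submodule.smul_of_tower_mem _ _ ?_
    rw [pow_add]
    exact Ideal.mul_mem_right _ _ (Ideal.pow_mem_pow (L_mem_M w) r)
  have := Ideal.add_mem _ h1 h2
  simpa using this

lemma span_top (r : ℕ) (v w : ℂ × ℂ) (hw : v.1 * w.2 - v.2 * w.1 = 1) (I : Ideal R)
    (hI : J r v ≤ I) :
    ⊤ ≤ Submodule.span ℂ (Set.range fun k : Fin r => Ideal.Quotient.mk I (L w ^ (k : ℕ))) := by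
  rintro x -
  obtain ⟨p, rfl⟩ := Ideal.Quotient.mk_surjective x
  have h := hI (sub_mem_J r v w hw p)
  rw [← Ideal.Quotient.eq] at h
  rw [h, map_sum]
  refine Submodule.sum_mem _ fun k _ => ?_
  have : Ideal.Quotient.mk I ((phi v p).coeff k • L w ^ (k : ℕ))
      = (phi v p).coeff k • Ideal.Quotient.mk I (L w ^ (k : ℕ)) := rfl
  rw [this]
  exact Submodule.smul_mem _ _ (Submodule.subset_span ⟨k, rfl⟩)

lemma finrank_eig {V : Type*} [AddCommGroup V] [Module ℂ V] (r : ℕ) (τ : Module.End ℂ V)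
    (u : Fin r → V) (μ : Fin r → ℂ) (hμ : Function.Injective μ) (hu : ∀ k, u k ≠ 0)
    (he : ∀ k, τ (u k) = μ k • u k) (hs : ⊤ ≤ Submodule.span ℂ (Set.range u)) (k : Fin r) :
    Module.finrank ℂ (Module.End.eigenspace τ (μ k)) = 1 := by
  have hli : LinearIndependent ℂ u := Module.End.eigenvectors_linearIndependent' τ μ hμ u
    fun k => ⟨Module.End.mem_eigenspace_iff.2 (he k), hu k⟩
  rw [finrank_eq_one_iff']
  refine ⟨⟨u k, Module.End.mem_eigenspace_iff.2 (he k)⟩, ?_, ?_⟩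
  · intro h
    exact hu k (congrArg Subtype.val h)
  · rintro ⟨x, hx⟩
    rw [Module.End.mem_eigenspace_iff] at hx
    obtain ⟨c, rfl⟩ := (Submodule.mem_span_range_iff_exists_fun ℂ).1 (hs (Submodule.mem_top (x := x)))
    have h0 : ∑ j, (c j * (μ j - μ k)) • u j = 0 := by
      rw [map_sum, Finset.smul_sum] at hx
      rw [← sub_eq_zero, ← Finset.sum_sub_distrib] at hx
      rw [← hx]
      refine Finset.sum_congr rfl fun j _ => ?_
      rw [map_smul, he, smul_smul, smul_smul, ← sub_smul]
      congr 1
      ring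
    have h1 := Fintype.linearIndependent_iff.1 hli _ h0
    refine ⟨c k, Subtype.ext ?_⟩
    show c k • u k = ∑ i, c i • u i
    rw [Finset.sum_eq_single k]
    · intro j _ hj
      have := h1 j
      rcases mul_eq_zero.1 this with h | h
      · simp [h]
      · exact absurd (hμ (sub_eq_zero.1 h)) hj
    · simp

lemma M_pow_le (g : R →ₐ[ℂ] R) (c : ℂ) (h0 : g (X 0) = c • X 0) (h1 : g (X 1) = c • X 1)
    (n : ℕ) : M ^ n ≤ Ideal.span {p | p ∈ M ^ n ∧ g p = c ^ n • p} := by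
  induction n with
  | zero =>
    have : (1 : R) ∈ Ideal.span {p | p ∈ M ^ 0 ∧ g p = c ^ 0 • p} :=
      Ideal.subset_span ⟨by simp, by simp⟩
    rw [(Ideal.eq_top_iff_one _).2 this]
    exact le_top
  | succ n ih =>
    rw [pow_succ]
    refine le_trans (Ideal.mul_mono_left ih) ?_
    rw [Ideal.span_mul_span', Ideal.span_le]
    rintro _ ⟨p, ⟨hp, hgp⟩, q, hq, rfl⟩
    have hqM : q ∈ M := Ideal.subset_span hq
    have hgq : g q = c • q := by
      rcases hq with rfl | rfl
      · exact h0
      · exact h1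
    refine Ideal.subset_span ⟨Ideal.mul_mem_mul hp hqM, ?_⟩
    simp only [map_mul, hgp, hgq, smul_mul_smul_comm, pow_succ]

end PunctualHilb

/-- Let `r ≥ 2`, `ζ` a primitive `r`-th root of unity, `σ` the `ℂ`-algebra
automorphism of `ℂ[X,Y]` with `σ(X) = ζ·X`, `σ(Y) = ζ·Y`.  Sending the line through a
nonzero `(a,b) ∈ ℂ²` to the ideal `(a·X + b·Y) + m^r` is a bijection from `ℙ(ℂ²)` onto
the set of ideals `I` with `m^N ⊆ I` for some `N`, `σ(I) = I`, and all eigenspaces of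
the induced endomorphism of `ℂ[X,Y]/I` with eigenvalues `ζ^k` (`0 ≤ k < r`)
one-dimensional. -/
theorem stmt_3 (r : ℕ) (hr : 2 ≤ r) (ζ : ℂ) (hζ : IsPrimitiveRoot ζ r)
    (σ : MvPolynomial (Fin 2) ℂ ≃ₐ[ℂ] MvPolynomial (Fin 2) ℂ)
    (hσX : σ (X 0) = ζ • X 0) (hσY : σ (X 1) = ζ • X 1)
    (m : Ideal (MvPolynomial (Fin 2) ℂ))
    (hm : m = Ideal.span {X 0, X 1}) :
    ∃ F : Projectivization ℂ (ℂ × ℂ) → Ideal (MvPolynomial (Fin 2) ℂ),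
      (∀ (v : ℂ × ℂ) (hv : v ≠ 0),
        F (Projectivization.mk ℂ v hv) =
          Ideal.span {C v.1 * X 0 + C v.2 * X 1} ⊔ m ^ r) ∧
      Set.BijOn F Set.univ
        {I : Ideal (MvPolynomial (Fin 2) ℂ) |
          (∃ N : ℕ, m ^ N ≤ I) ∧
          σ '' (I : Set (MvPolynomial (Fin 2) ℂ)) = (I : Set (MvPolynomial (Fin 2) ℂ)) ∧
          ∃ τ : (MvPolynomial (Fin 2) ℂ ⧸ I) →ₗ[ℂ] (MvPolynomial (Fin 2) ℂ ⧸ I),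
            (∀ p : MvPolynomial (Fin 2) ℂ,
              τ (Ideal.Quotient.mk I p) = Ideal.Quotient.mk I (σ p)) ∧
            ∀ k : ℕ, k < r →
              Module.finrank ℂ (Module.End.eigenspace τ (ζ ^ k)) = 1} := by
  classical
  subst hm
  have hζ0 : ζ ≠ 0 := hζ.ne_zero (by omega)
  have hinj : Function.Injective fun k : Fin r => ζ ^ (k : ℕ) := fun i j h =>
    Fin.ext (hζ.pow_inj i.2 j.2 h)
  have hs0 : σ.symm (X 0) = ζ⁻¹ • X 0 := by
    rw [AlgEquiv.symm_apply_eq, map_smul, hσX, smul_smul, inv_mul_cancel₀ hζ0, one_smul]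
  have hs1 : σ.symm (X 1) = ζ⁻¹ • X 1 := by
    rw [AlgEquiv.symm_apply_eq, map_smul, hσY, smul_smul, inv_mul_cancel₀ hζ0, one_smul]
  have hpow : ∀ (w : ℂ × ℂ) (k : ℕ),
      σ (PunctualHilb.L w ^ k) = ζ ^ k • PunctualHilb.L w ^ k := by
    intro w k
    have := PunctualHilb.map_L (σ : _ →ₐ[ℂ] _) ζ hσX hσY w
    rw [map_pow]
    erw [this]
    rw [smul_pow]
  have hF : ∀ (v : ℂ × ℂ) (hv : v ≠ 0),
      PunctualHilb.J r (Projectivization.mk ℂ v hv).rep = PunctualHilb.J r v := by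
    intro v hv
    obtain ⟨a, ha⟩ := Projectivization.exists_smul_eq_mk_rep ℂ v hv
    rw [← ha]
    have : PunctualHilb.L (a • v) = C (a : ℂ) * PunctualHilb.L v := by
      simp [PunctualHilb.L, Units.smul_def]
      ring
    unfold PunctualHilb.J
    rw [this, Ideal.span_singleton_mul_left_unit (a.isUnit.map C)]
  refine ⟨fun P => PunctualHilb.J r P.rep, hF, ?_, ?_, ?_⟩
  · intro P _
    set v := P.rep
    have hv : v ≠ 0 := P.rep_nonzero
    obtain ⟨w, hw⟩ := PunctualHilb.exists_compl v hv
    have hle := PunctualHilb.J_le_comap r v (σ : _ →ₐ[ℂ] _) ζ hσX hσY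
    have hle' := PunctualHilb.J_le_comap r v (σ.symm : _ →ₐ[ℂ] _) ζ⁻¹ hs0 hs1
    refine ⟨⟨r, le_sup_right⟩, ?_,
      (Ideal.quotientMapₐ (PunctualHilb.J r v) (σ : _ →ₐ[ℂ] _) hle).toLinearMap,
      fun p => rfl, ?_⟩
    · ext p
      constructor
      · rintro ⟨q, hq, rfl⟩
        exact hle hq
      · intro hp
        exact ⟨σ.symm p, hle' hp, σ.apply_symm_apply p⟩
    · intro k hk
      refine PunctualHilb.finrank_eig r _
        (fun k : Fin r => Ideal.Quotient.mk (PunctualHilb.J r v) (PunctualHilb.L w ^ (k : ℕ)))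
        (fun k : Fin r => ζ ^ (k : ℕ)) hinj ?_ ?_
        (PunctualHilb.span_top r v w hw _ le_rfl) ⟨k, hk⟩
      · intro j h
        exact PunctualHilb.pow_notMem r v w hw j j.2 (Ideal.Quotient.eq_zero_iff_mem.1 h)
      · intro j
        show Ideal.Quotient.mk (PunctualHilb.J r v) (σ (PunctualHilb.L w ^ (j : ℕ))) = _
        rw [hpow]
        rfl
  · intro P _ Q _ h
    induction P using Projectivization.ind with | _ v hv
    induction Q using Projectivization.ind with | _ w hw
    simp only [hF] at h
    have h1 : PunctualHilb.L w ∈ PunctualHilb.J r v := by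
      rw [h]
      exact Ideal.mem_sup_left (Ideal.subset_span rfl)
    have h2 := PunctualHilb.J_le_phi r v h1
    rw [Ideal.mem_comap, PunctualHilb.phi_L, Ideal.mem_span_singleton,
      Polynomial.X_pow_dvd_iff] at h2
    have h3 := h2 1 (by omega)
    rw [Polynomial.coeff_C_mul, Polynomial.coeff_X_one, mul_one] at h3
    rw [Projectivization.mk_eq_mk_iff']
    obtain ⟨u, hu⟩ := PunctualHilb.exists_compl w hw
    refine ⟨v.1 * u.2 - v.2 * u.1, Prod.ext ?_ ?_⟩
    · simp only [Prod.smul_fst, smul_eq_mul]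
      linear_combination v.1 * hu + u.1 * h3
    · simp only [Prod.smul_snd, smul_eq_mul]
      linear_combination v.2 * hu + u.2 * h3
  · rintro I ⟨⟨N, hN⟩, -, τ, hτ, hfin⟩
    have hmem : ∀ (k : ℕ) (p : MvPolynomial (Fin 2) ℂ), σ p = ζ ^ k • p →
        Ideal.Quotient.mk I p ∈ Module.End.eigenspace τ (ζ ^ k) := by
      intro k p hp
      rw [Module.End.mem_eigenspace_iff, hτ, hp]
      rfl
    have hmk : ∀ (c : ℂ) (p : MvPolynomial (Fin 2) ℂ),
      Ideal.Quotient.mk I (c • p) = c • Ideal.Quotient.mk I p := fun _ _ => rfl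
    have hnt : Nontrivial (MvPolynomial (Fin 2) ℂ ⧸ I) := by
      have := Module.nontrivial_of_finrank_pos
        (R := ℂ) (M := Module.End.eigenspace τ (ζ ^ 0)) (by rw [hfin 0 (by omega)]; exact one_pos)
      exact Function.Injective.nontrivial Subtype.val_injective
        (α := Module.End.eigenspace τ (ζ ^ 0))
    have hMr : PunctualHilb.M ^ r ≤ I := by
      refine (PunctualHilb.M_pow_le (σ : _ →ₐ[ℂ] _) ζ hσX hσY r).trans ?_
      rw [Ideal.span_le]
      rintro p ⟨hpM, hp⟩
      have hp' : σ p = ζ ^ 0 • p := by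
        rw [pow_zero, ← hζ.pow_eq_one]
        exact hp
      have h1 := hmem 0 1 (by simp)
      have h2 := hmem 0 p hp'
      obtain ⟨c, hc⟩ := (finrank_eq_one_iff_of_nonzero'
        (⟨_, h1⟩ : Module.End.eigenspace τ (ζ ^ 0))
        (fun h => one_ne_zero (α := MvPolynomial (Fin 2) ℂ ⧸ I)
          (by simpa using congrArg Subtype.val h))).1 (hfin 0 (by omega)) ⟨_, h2⟩
      have hc' : c • (1 : MvPolynomial (Fin 2) ℂ ⧸ I) = Ideal.Quotient.mk I p := by
        simpa using congrArg Subtype.val hc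
      have hpN : Ideal.Quotient.mk I p ^ N = 0 := by
        rw [← map_pow, Ideal.Quotient.eq_zero_iff_mem]
        apply hN
        refine Ideal.pow_mem_pow (Ideal.pow_le_self (by omega) hpM) N
      rw [← hc', smul_pow, one_pow, smul_eq_zero] at hpN
      have hc0 : c = 0 := by
        rcases hpN with h | h
        · exact eq_zero_of_pow_eq_zero h
        · exact absurd h one_ne_zero
      rw [hc0, zero_smul] at hc'
      exact Ideal.Quotient.eq_zero_iff_mem.1 hc'.symm
    obtain ⟨v, hv, hvI⟩ : ∃ v : ℂ × ℂ, v ≠ 0 ∧ PunctualHilb.L v ∈ I := by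
      have hL : ∀ v : ℂ × ℂ, PunctualHilb.L v = v.1 • X 0 + v.2 • X 1 := by
        intro v
        simp [PunctualHilb.L, MvPolynomial.smul_eq_C_mul]
      have h0 := hmem 1 (X 0) (by rw [pow_one, hσX])
      have h1 := hmem 1 (X 1) (by rw [pow_one, hσY])
      by_cases hz : Ideal.Quotient.mk I (X 0) = 0
      · refine ⟨(1, 0), by simp, ?_⟩
        rw [hL]
        simpa using Ideal.Quotient.eq_zero_iff_mem.1 hz
      · obtain ⟨c, hc⟩ := (finrank_eq_one_iff_of_nonzero'
          (⟨_, h0⟩ : Module.End.eigenspace τ (ζ ^ 1))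
          (fun h => hz (congrArg Subtype.val h))).1 (hfin 1 (by omega)) ⟨_, h1⟩
        have hc' : c • Ideal.Quotient.mk I (X 0) = Ideal.Quotient.mk I (X 1) :=
          congrArg Subtype.val hc
        refine ⟨(c, -1), by simp, ?_⟩
        rw [← Ideal.Quotient.eq_zero_iff_mem, hL, map_add, hmk, hmk, hc']
        simp
    have hJI : PunctualHilb.J r v ≤ I :=
      sup_le ((Ideal.span_singleton_le_iff_mem _).2 hvI) hMr
    obtain ⟨w, hw⟩ := PunctualHilb.exists_compl v hv
    have hspan := PunctualHilb.span_top r v w hw I hJI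
    refine ⟨Projectivization.mk ℂ v hv, trivial, ?_⟩
    show PunctualHilb.J r (Projectivization.mk ℂ v hv).rep = I
    rw [hF]
    refine le_antisymm hJI ?_
    have hfd : Module.Finite ℂ (MvPolynomial (Fin 2) ℂ ⧸ I) :=
      ⟨⟨(Set.finite_range fun k : Fin r =>
          Ideal.Quotient.mk I (PunctualHilb.L w ^ (k : ℕ))).toFinset, by
        rw [Set.Finite.coe_toFinset]; exact top_le_iff.1 hspan⟩⟩
    have hex : ∀ k : Fin r, ∃ u, Module.End.HasEigenvector τ (ζ ^ (k : ℕ)) u := by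
      intro k
      have := Module.nontrivial_of_finrank_pos
        (R := ℂ) (M := Module.End.eigenspace τ (ζ ^ (k : ℕ)))
        (by rw [hfin k k.2]; exact one_pos)
      obtain ⟨u, hu⟩ := exists_ne (0 : Module.End.eigenspace τ (ζ ^ (k : ℕ)))
      exact ⟨u, u.2, fun h => hu (Subtype.ext h)⟩
    choose u hu using hex
    have hli := Module.End.eigenvectors_linearIndependent' τ _ hinj u hu
    have hge := hli.fintype_card_le_finrank
    have hcard : Fintype.card (Fin r) = Module.finrank ℂ (MvPolynomial (Fin 2) ℂ ⧸ I) := by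
      refine le_antisymm hge ?_
      have := finrank_range_le_card (R := ℂ)
        (fun k : Fin r => Ideal.Quotient.mk I (PunctualHilb.L w ^ (k : ℕ)))
      rwa [Set.finrank, top_le_iff.1 hspan, finrank_top] at this
    have hli2 := linearIndependent_of_top_le_span_of_card_eq_finrank hspan hcard
    intro p hp
    have h1 := PunctualHilb.sub_mem_J r v w hw p
    have h2 := hJI h1
    rw [← Ideal.Quotient.eq, Ideal.Quotient.eq_zero_iff_mem.2 hp, map_sum] at h2
    have h3 := Fintype.linearIndependent_iff.1 hli2
      (fun k => (PunctualHilb.phi v p).coeff k) h2.symm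
    rw [Finset.sum_eq_zero (fun k _ => by rw [h3 k, zero_smul]), sub_zero] at h1
    exact h1
end

section
/- Let V be a ℚ-vector space equipped with a symmetric bilinear form ⟨·,·⟩. Let r′ and r″ be positive integers, let c₁′, c₁″ ∈ V, and let c₂′, c₂″ ∈ ℚ. Set r = r′ + r″, c₁ = c₁′ + c₁″, c₂ = c₂′ + c₂″ + ⟨c₁′, c₁″⟩, and define the discriminants Δ′ = 2·r′·c₂′ − (r′−1)·⟨c₁′,c₁′⟩, Δ″ = 2·r″·c₂″ − (r″−1)·⟨c₁″,c₁″⟩, Δ = 2·r·c₂ − (r−1)·⟨c₁,c₁⟩, and set ξ = r·c₁′ − r′·c₁. Then Δ = (r/r′)·Δ′ + (r/r″)·Δ″ − ⟨ξ,ξ⟩/(r′·r″). -/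
/-- discriminant identity. With `r = r′ + r″`, `c₁ = c₁′ + c₁″`,
`c₂ = c₂′ + c₂″ + ⟨c₁′, c₁″⟩`, discriminants `Δ = 2·r·c₂ − (r−1)·⟨c₁,c₁⟩` (and likewise
for the primed data), and `ξ = r·c₁′ − r′·c₁`, one has
`Δ = (r/r′)·Δ′ + (r/r″)·Δ″ − ⟨ξ,ξ⟩/(r′·r″)`. -/
theorem stmt_6 (V : Type*) [AddCommGroup V] [Module ℚ V]
    (B : LinearMap.BilinForm ℚ V) (hsymm : ∀ x y, B x y = B y x)
    (r' r'' : ℕ) (hr' : 0 < r') (hr'' : 0 < r'')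
    (c₁' c₁'' : V) (c₂' c₂'' : ℚ)
    (r : ℕ) (hrdef : r = r' + r'')
    (c₁ : V) (hc₁ : c₁ = c₁' + c₁'')
    (c₂ : ℚ) (hc₂ : c₂ = c₂' + c₂'' + B c₁' c₁'')
    (Δ' Δ'' Δ : ℚ)
    (hΔ' : Δ' = 2 * (r' : ℚ) * c₂' - ((r' : ℚ) - 1) * B c₁' c₁')
    (hΔ'' : Δ'' = 2 * (r'' : ℚ) * c₂'' - ((r'' : ℚ) - 1) * B c₁'' c₁'')
    (hΔ : Δ = 2 * (r : ℚ) * c₂ - ((r : ℚ) - 1) * B c₁ c₁)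
    (ξ : V) (hξ : ξ = (r : ℚ) • c₁' - (r' : ℚ) • c₁) :
    Δ = ((r : ℚ) / (r' : ℚ)) * Δ' + ((r : ℚ) / (r'' : ℚ)) * Δ'' -
      B ξ ξ / ((r' : ℚ) * (r'' : ℚ)) := by
  have h1 : (r' : ℚ) ≠ 0 := by exact_mod_cast hr'.ne'
  have h2 : (r'' : ℚ) ≠ 0 := by exact_mod_cast hr''.ne'
  subst hrdef hc₁ hc₂ hΔ' hΔ'' hΔ hξ
  simp only [map_add, map_sub, map_smul, LinearMap.add_apply, LinearMap.sub_apply,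
    LinearMap.smul_apply, smul_eq_mul, hsymm c₁'' c₁', Nat.cast_add]
  field_simp
  ring
end
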